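/- Let C_1, C_2, C_3, C_4 be the 6×6 rational matrices arising from the Butterfly subdivision scheme with ω = 1/16 (defined in the context), and let w_1 = (1/4, 1/4, 0, 0, 1, 0)ᵀ, w_2 = (1/4, 0, 1/4, 0, 0, 1)ᵀ, and w_3 = (−1/7, −25/28, −25/28, −2/7, 1, 1)ᵀ. Then w_1 is an eigenvector of C_1 C_2 with eigenvalue 1, w_2 is an eigenvector of C_1 C_3 with eigenvalue 1, w_3 is an eigenvector of C_2 C_3 with eigenvalue 1, and each of the two-dimensional subspaces V_1 = span{w_1, C_4 w_1}, V_2 = span{w_2, C_4 w_2}, V_3 = span{w_3, C_1 w_3} is invariant under all four matrices: C_i V_k ⊆ V_k for all i ∈ {1, 2, 3, 4} and k ∈ {1, 2, 3}. -/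

import Mathlib

open Matrix

/-- The matrix `C₁` of the Butterfly scheme with `ω = 1/16`. -/
noncomputable def C1 : Matrix (Fin 6) (Fin 6) ℝ :=
  !![1, 0, 0, -1/4,   0,   0;
     0, 0, 0,    0, 1/4,   0;
     0, 0, 0,    0,   0, 1/4;
     0, 0, 0, -1/4,   0,   0;
     0, 1, 0,    0, 3/4,   0;
     0, 0, 1,    0,   0, 3/4]

/-- The matrix `C₂` of the Butterfly scheme with `ω = 1/16`. -/
noncomputable def C2 : Matrix (Fin 6) (Fin 6) ℝ :=
  !![0, 1/4,    0,   1/12,  3/16,  -1/12;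
     1, 3/4,  3/4, -23/12, -3/16,  11/48;
     0,   0, -1/4,  25/12,     0, -25/48;
     0,   0,    0,   5/12,     0,   -1/6;
     0,   0,   -1,    5/3,     1,  -5/12;
     0,   0,    0,   -7/3,     0,    1/3]

/-- The matrix `C₃` of the Butterfly scheme with `ω = 1/16`. -/
noncomputable def C3 : Matrix (Fin 6) (Fin 6) ℝ :=
  !![0,    0, 1/4,   1/12,  -1/12,  3/16;
     0, -1/4,   0,  25/12, -25/48,     0;
     1,  3/4, 3/4, -23/12,  11/48, -3/16;
     0,    0,   0,   5/12,   -1/6,     0;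
     0,    0,   0,   -7/3,    1/3,     0;
     0,   -1,   0,    5/3,  -5/12,     1]

/-- The matrix `C₄` of the Butterfly scheme with `ω = 1/16`. -/
noncomputable def C4 : Matrix (Fin 6) (Fin 6) ℝ :=
  !![0,  -1/12,  -1/12, -1/4,    5/48,    5/48;
     0,    5/3, -25/12,    0,     5/3, -103/48;
     0, -25/12,    5/3,    0, -103/48,     5/3;
     1,    1/3,    1/3, -1/4,     1/3,     1/3;
     0,   -5/3,    7/3,    0,  -23/12,   25/12;
     0,    7/3,   -5/3,    0,   25/12,  -23/12]

noncomputable def wv1 : Fin 6 → ℝ := ![1/4, 1/4, 0, 0, 1, 0]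

noncomputable def wv2 : Fin 6 → ℝ := ![1/4, 0, 1/4, 0, 0, 1]

noncomputable def wv3 : Fin 6 → ℝ := ![-1/7, -25/28, -25/28, -2/7, 1, 1]

/-- V₁ = span{w₁, C₄ w₁}. -/
noncomputable def V1 : Submodule ℝ (Fin 6 → ℝ) := Submodule.span ℝ {wv1, C4 *ᵥ wv1}

/-- V₂ = span{w₂, C₄ w₂}. -/
noncomputable def V2 : Submodule ℝ (Fin 6 → ℝ) := Submodule.span ℝ {wv2, C4 *ᵥ wv2}

/-- V₃ = span{w₃, C₁ w₃}. -/
noncomputable def V3 : Submodule ℝ (Fin 6 → ℝ) := Submodule.span ℝ {wv3, C1 *ᵥ wv3}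

lemma C4_wv1 : C4 *ᵥ wv1 = ![1/12, 25/12, -8/3, 2/3, -7/3, 8/3] := by
  ext i
  fin_cases i <;> simp [C4, wv1, Matrix.mulVec, dotProduct, Fin.sum_univ_succ] <;> norm_num

lemma C4_wv2 : C4 *ᵥ wv2 = ![1/12, -8/3, 25/12, 2/3, 8/3, -7/3] := by
  ext i
  fin_cases i <;> simp [C4, wv2, Matrix.mulVec, dotProduct, Fin.sum_univ_succ] <;> norm_num

lemma C1_wv3 : C1 *ᵥ wv3 = ![-1/14, 1/4, 1/4, 1/14, -1/7, -1/7] := by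
  ext i
  fin_cases i <;> simp [C1, wv3, Matrix.mulVec, dotProduct, Fin.sum_univ_succ] <;> norm_num

/-- A span of two vectors is invariant as soon as the images of both generators
are explicit combinations of the generators. -/
lemma span_pair_invariant (C : Matrix (Fin 6) (Fin 6) ℝ) (u v : Fin 6 → ℝ) (a b c d : ℝ)
    (hu : a • u + b • v = C *ᵥ u) (hv : c • u + d • v = C *ᵥ v) :
    ∀ x ∈ Submodule.span ℝ {u, v}, C *ᵥ x ∈ Submodule.span ℝ {u, v} := by
  intro x hx
  obtain ⟨p, q, rfl⟩ := Submodule.mem_span_pair.1 hx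
  rw [Matrix.mulVec_add, Matrix.mulVec_smul, Matrix.mulVec_smul]
  exact Submodule.add_mem _
    (Submodule.smul_mem _ _ (Submodule.mem_span_pair.2 ⟨a, b, hu⟩))
    (Submodule.smul_mem _ _ (Submodule.mem_span_pair.2 ⟨c, d, hv⟩))

set_option maxHeartbeats 4000000 in
/-- `w₁`, `w₂`, `w₃` are eigenvectors with eigenvalue `1` of `C₁C₂`, `C₁C₃`,
`C₂C₃` respectively, and the two-dimensional subspaces `V₁ = span{w₁, C₄w₁}`,
`V₂ = span{w₂, C₄w₂}`, `V₃ = span{w₃, C₁w₃}` are invariant under all of `C₁, C₂, C₃, C₄`. -/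
theorem butterfly_invariant_subspaces :
    (C1 * C2) *ᵥ wv1 = wv1 ∧
    (C1 * C3) *ᵥ wv2 = wv2 ∧
    (C2 * C3) *ᵥ wv3 = wv3 ∧
    (∀ C ∈ ({C1, C2, C3, C4} : Set (Matrix (Fin 6) (Fin 6) ℝ)),
      ∀ V ∈ ({V1, V2, V3} : Set (Submodule ℝ (Fin 6 → ℝ))),
        ∀ x ∈ V, C *ᵥ x ∈ V) := by
  refine ⟨?_, ?_⟩
  · rw [← Matrix.mulVec_mulVec]
    ext i
    fin_cases i <;> simp [C1, C2, wv1, Matrix.mulVec, dotProduct, Fin.sum_univ_succ] <;> norm_num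
  refine ⟨?_, ?_⟩
  · rw [← Matrix.mulVec_mulVec]
    ext i
    fin_cases i <;> simp [C1, C3, wv2, Matrix.mulVec, dotProduct, Fin.sum_univ_succ] <;> norm_num
  refine ⟨?_, ?_⟩
  · rw [← Matrix.mulVec_mulVec]
    ext i
    fin_cases i <;> simp [C2, C3, wv3, Matrix.mulVec, dotProduct, Fin.sum_univ_succ] <;> norm_num
  intro C hC V hV
  simp only [Set.mem_insert_iff, Set.mem_singleton_iff] at hC hV
  rcases hC with rfl | rfl | rfl | rfl <;> rcases hV with rfl | rfl | rfl
  · rw [V1, C4_wv1]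
    apply span_pair_invariant _ _ _ 1 0 (-1/4) (-1/4) <;> ext i <;> fin_cases i <;>
      simp [C1, wv1, Matrix.mulVec, dotProduct, Fin.sum_univ_succ] <;> norm_num
  · rw [V2, C4_wv2]
    apply span_pair_invariant _ _ _ 1 0 (-1/4) (-1/4) <;> ext i <;> fin_cases i <;>
      simp [C1, wv2, Matrix.mulVec, dotProduct, Fin.sum_univ_succ] <;> norm_num
  · rw [V3, C1_wv3]
    apply span_pair_invariant _ _ _ 0 1 (1/4) (3/4) <;> ext i <;> fin_cases i <;>
      simp [C1, wv3, Matrix.mulVec, dotProduct, Fin.sum_univ_succ] <;> norm_num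
  · rw [V1, C4_wv1]
    apply span_pair_invariant _ _ _ 1 0 (-1/4) (-1/4) <;> ext i <;> fin_cases i <;>
      simp [C2, wv1, Matrix.mulVec, dotProduct, Fin.sum_univ_succ] <;> norm_num
  · rw [V2, C4_wv2]
    apply span_pair_invariant _ _ _ (-1/4) (-1/4) 0 1 <;> ext i <;> fin_cases i <;>
      simp [C2, wv2, Matrix.mulVec, dotProduct, Fin.sum_univ_succ] <;> norm_num
  · rw [V3, C1_wv3]
    apply span_pair_invariant _ _ _ 1 0 (-1/4) (-1/4) <;> ext i <;> fin_cases i <;>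
      simp [C2, wv3, Matrix.mulVec, dotProduct, Fin.sum_univ_succ] <;> norm_num
  · rw [V1, C4_wv1]
    apply span_pair_invariant _ _ _ (-1/4) (-1/4) 0 1 <;> ext i <;> fin_cases i <;>
      simp [C3, wv1, Matrix.mulVec, dotProduct, Fin.sum_univ_succ] <;> norm_num
  · rw [V2, C4_wv2]
    apply span_pair_invariant _ _ _ 1 0 (-1/4) (-1/4) <;> ext i <;> fin_cases i <;>
      simp [C3, wv2, Matrix.mulVec, dotProduct, Fin.sum_univ_succ] <;> norm_num
  · rw [V3, C1_wv3]
    apply span_pair_invariant _ _ _ 1 0 (-1/4) (-1/4) <;> ext i <;> fin_cases i <;>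
      simp [C3, wv3, Matrix.mulVec, dotProduct, Fin.sum_univ_succ] <;> norm_num
  · rw [V1, C4_wv1]
    apply span_pair_invariant _ _ _ 0 1 (-1/4) (-1/4) <;> ext i <;> fin_cases i <;>
      simp [C4, wv1, Matrix.mulVec, dotProduct, Fin.sum_univ_succ] <;> norm_num
  · rw [V2, C4_wv2]
    apply span_pair_invariant _ _ _ 0 1 (-1/4) (-1/4) <;> ext i <;> fin_cases i <;>
      simp [C4, wv2, Matrix.mulVec, dotProduct, Fin.sum_univ_succ] <;> norm_num
  · rw [V3, C1_wv3]
    apply span_pair_invariant _ _ _ (-1) (-4) (1/4) (3/4) <;> ext i <;> fin_cases i <;>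
      simp [C4, wv3, Matrix.mulVec, dotProduct, Fin.sum_univ_succ] <;> norm_num
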